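/- For every positive integer n, cf(n) ≤ 5·⌈n/25⌉; that is, for every n there exists a set of n points in the plane in general position whose largest crossing family has size at most 5·⌈n/25⌉. -/

import Mathlib

/-- A finite set of points in the plane is in *general position* if no three of
its points are collinear. -/
def GenPos (S : Finset (ℝ × ℝ)) : Prop :=
  ∀ p ∈ S, ∀ q ∈ S, ∀ r ∈ S, p ≠ q → p ≠ r → q ≠ r →
    ¬Collinear ℝ ({p, q, r} : Set (ℝ × ℝ))

/-- Two closed segments `pq` and `rs` *cross* if they intersect in exactly one
point, which lies in the interior of both segments. -/
def Crosses (p q r s : ℝ × ℝ) : Prop :=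
  ∃ x : ℝ × ℝ, x ∈ openSegment ℝ p q ∧ x ∈ openSegment ℝ r s ∧
    segment ℝ p q ∩ segment ℝ r s = {x}

/-- `F` is a *crossing family* in `S`: a finite set of segments (given by their
pairs of distinct endpoints, which belong to `S`) that pairwise cross. -/
def IsCrossingFamily (S : Finset (ℝ × ℝ)) (F : Finset ((ℝ × ℝ) × (ℝ × ℝ))) : Prop :=
  (∀ e ∈ F, e.1 ∈ S ∧ e.2 ∈ S ∧ e.1 ≠ e.2) ∧
  (∀ e ∈ F, ∀ f ∈ F, e ≠ f → Crosses e.1 e.2 f.1 f.2)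

/-- `S` contains a `k`-crossing family. -/
def HasCrossingFamily (S : Finset (ℝ × ℝ)) (k : ℕ) : Prop :=
  ∃ F : Finset ((ℝ × ℝ) × (ℝ × ℝ)), IsCrossingFamily S F ∧ F.card = k

/-- `cf S`: the maximum size of a crossing family in `S`. -/
noncomputable def cf (S : Finset (ℝ × ℝ)) : ℕ :=
  sSup {k : ℕ | HasCrossingFamily S k}

/-- `cfNat n`: the minimum of `cf S` over all sets `S` of `n` points in
general position. -/
noncomputable def cfNat (n : ℕ) : ℕ :=
  sInf {m : ℕ | ∃ S : Finset (ℝ × ℝ), S.card = n ∧ GenPos S ∧ cf S = m}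

open Finset

/-! ### König's theorem -/

/-- König's theorem for a finite family of edges `e` joining `l e` to `r e` in a bipartite graph:
there is a matching of size `k + 1` or a vertex cover of size at most `k`. -/
theorem exists_matching_or_cover {E β : Type*} [Fintype E] [Fintype β] [DecidableEq β]
    (l r : E → β) (k : ℕ) :
    (∃ M : Finset E, M.card = k + 1 ∧ Set.InjOn l M ∧ Set.InjOn r M) ∨
      ∃ A B : Finset β, A.card + B.card ≤ k ∧ ∀ e, l e ∈ A ∨ r e ∈ B := by
  classical
  let N : β → Finset β := fun x => (univ.filter fun e => l e = x).image r
  obtain ⟨X, -, hX⟩ := exists_min_image (univ : Finset (Finset β))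
    (fun s => sᶜ.card + (s.biUnion N).card) ⟨∅, mem_univ _⟩
  have hX' := fun s => hX s (mem_univ s)
  clear hX
  set c := Xᶜ.card + (X.biUnion N).card with hc
  by_cases hck : c ≤ k
  · refine Or.inr ⟨Xᶜ, X.biUnion N, hck, fun e => ?_⟩
    by_cases he : l e ∈ X
    · exact Or.inr (mem_biUnion.2 ⟨l e, he, mem_image.2 ⟨e, by simp, rfl⟩⟩)
    · exact Or.inl (mem_compl.2 he)
  · left
    have hcβ : c ≤ Fintype.card β := by simpa using hX' ∅
    obtain ⟨f, hf, hfN⟩ := (all_card_le_biUnion_card_iff_exists_injective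
      (fun x => (N x).disjSum (univ : Finset (Fin (Fintype.card β - c))))).1 (by
        intro s
        rcases s.eq_empty_or_nonempty with rfl | ⟨x₀, hx₀⟩
        · simp
        · have hsub : (s.biUnion N).disjSum univ ⊆ s.biUnion
              fun x => (N x).disjSum (univ : Finset (Fin (Fintype.card β - c))) := by
            intro y hy
            rcases y with y | y
            · simpa using hy
            · simpa using ⟨x₀, hx₀⟩
          have h1 := card_le_card hsub
          rw [card_disjSum, card_univ, Fintype.card_fin] at h1
          have h2 := hX' s
          have h3 := card_compl s
          have h4 := card_le_univ s
          omega)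
    have hedge : ∀ x : {x // (f x).isLeft = true}, ∃ e, l e = x ∧ Sum.inl (r e) = f x := by
      rintro ⟨x, hx⟩
      obtain ⟨y, hy⟩ := Sum.isLeft_iff.1 hx
      have h := hfN x
      rw [hy] at h
      simp only [N, inl_mem_disjSum, mem_image, mem_filter, mem_univ, true_and] at h
      obtain ⟨e, he, her⟩ := h
      exact ⟨e, he, by rw [hy, her]⟩
    choose g hgl hgr using hedge
    have hg : Function.Injective g := fun x y hxy => Subtype.ext (by rw [← hgl, ← hgl, hxy])
    have hcard : k + 1 ≤ ((univ : Finset {x // (f x).isLeft = true}).image g).card := by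
      rw [card_image_of_injective _ hg, card_univ, Fintype.card_subtype]
      have h1 : (univ.filter fun x => ¬(f x).isLeft = true).card ≤ Fintype.card β - c := by
        have h2 : ((univ.filter fun x => ¬(f x).isLeft = true).image f).card ≤
            ((univ : Finset (Fin (Fintype.card β - c))).image (Sum.inr (α := β))).card := by
          apply card_le_card
          intro y hy
          simp only [mem_image, mem_filter, mem_univ, true_and] at hy ⊢
          obtain ⟨x, hx, rfl⟩ := hy
          cases hfx : f x with
          | inl z => simp [hfx] at hx
          | inr z => exact ⟨z, rfl⟩
        rw [card_image_of_injective _ hf] at h2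
        exact h2.trans (card_image_le.trans (by simp))
      have h3 := card_filter_add_card_filter_not (s := (univ : Finset β))
        (fun x => (f x).isLeft = true)
      rw [card_univ] at h3
      omega
    obtain ⟨M, hM, hMk⟩ := exists_subset_card_eq hcard
    refine ⟨M, hMk, ?_, ?_⟩
    · intro a ha b hb hab
      obtain ⟨x, -, rfl⟩ := mem_image.1 (hM ha)
      obtain ⟨y, -, rfl⟩ := mem_image.1 (hM hb)
      rw [hgl, hgl] at hab
      rw [Subtype.ext hab]
    · intro a ha b hb hab
      obtain ⟨x, -, rfl⟩ := mem_image.1 (hM ha)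
      obtain ⟨y, -, rfl⟩ := mem_image.1 (hM hb)
      have h : f x = f y := by rw [← hgr, ← hgr, hab]
      rw [Subtype.ext (hf h)]

/-! ### Orientations and crossings -/

/-- Twice the signed area of the triangle `abc`; it is positive iff `abc` is a left turn. -/
def orient (a b c : ℝ × ℝ) : ℝ :=
  (b.1 - a.1) * (c.2 - a.2) - (b.2 - a.2) * (c.1 - a.1)

theorem orient_swap (a b c : ℝ × ℝ) : orient b a c = -orient a b c := by
  simp only [orient]; ring

theorem orient_rotate (a b c : ℝ × ℝ) : orient b c a = orient a b c := by
  simp only [orient]; ring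

theorem orient_eq_zero_of_collinear {a b c : ℝ × ℝ} (h : Collinear ℝ {a, b, c}) :
    orient a b c = 0 := by
  obtain ⟨v, hv⟩ := (collinear_iff_of_mem (p₀ := a) (by simp)).1 h
  obtain ⟨s, rfl⟩ := hv b (by simp)
  obtain ⟨t, rfl⟩ := hv c (by simp)
  simp only [orient, vadd_eq_add, Prod.fst_add, Prod.snd_add, Prod.smul_fst, Prod.smul_snd,
    smul_eq_mul]
  ring

theorem Crosses.symm {a b c d : ℝ × ℝ} (h : Crosses a b c d) : Crosses c d a b := by
  obtain ⟨x, hx, hy, h⟩ := h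
  exact ⟨x, hy, hx, by rw [Set.inter_comm, h]⟩

theorem Crosses.swap_left {a b c d : ℝ × ℝ} (h : Crosses a b c d) : Crosses b a c d := by
  obtain ⟨x, hx, hy, h⟩ := h
  exact ⟨x, by rwa [openSegment_symm], hy, by rwa [segment_symm]⟩

theorem Crosses.swap_right {a b c d : ℝ × ℝ} (h : Crosses a b c d) : Crosses a b d c :=
  h.symm.swap_left.symm

theorem Crosses.exists_smul_eq {a b c d : ℝ × ℝ} (h : Crosses a b c d) :
    ∃ s t : ℝ, 0 < s ∧ s < 1 ∧ 0 < t ∧ t < 1 ∧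
      (1 - s) * a.1 + s * b.1 = (1 - t) * c.1 + t * d.1 ∧
      (1 - s) * a.2 + s * b.2 = (1 - t) * c.2 + t * d.2 := by
  obtain ⟨x, ⟨s', s, hs', hs, hss, hx⟩, ⟨t', t, ht', ht, htt, hy⟩, -⟩ := h
  obtain rfl : s' = 1 - s := by linarith
  obtain rfl : t' = 1 - t := by linarith
  refine ⟨s, t, hs, by linarith, ht, by linarith, ?_, ?_⟩
  · simpa using congrArg Prod.fst (hx.trans hy.symm)
  · simpa using congrArg Prod.snd (hx.trans hy.symm)

/-- The endpoints of a crossing segment lie on different sides of the line `ab`. -/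
theorem Crosses.exists_orient_add_eq_zero {a b c d : ℝ × ℝ} (h : Crosses a b c d) :
    ∃ s t : ℝ, 0 < s ∧ 0 < t ∧ s * orient a b c + t * orient a b d = 0 := by
  obtain ⟨s, t, -, -, ht, ht', h1, h2⟩ := h.exists_smul_eq
  refine ⟨1 - t, t, by linarith, ht, ?_⟩
  simp only [orient]
  linear_combination (b.2 - a.2) * h1 - (b.1 - a.1) * h2

/-- The other endpoints of two crossing segments `ab`, `cd` lie on the same side of `ac`. -/
theorem Crosses.exists_orient_eq {a b c d : ℝ × ℝ} (h : Crosses a b c d) :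
    ∃ s t : ℝ, 0 < s ∧ 0 < t ∧ s * orient a c b = t * orient a c d := by
  obtain ⟨s, t, hs, -, ht, -, h1, h2⟩ := h.exists_smul_eq
  refine ⟨s, t, hs, ht, ?_⟩
  simp only [orient]
  linear_combination (c.1 - a.1) * h2 - (c.2 - a.2) * h1

theorem Crosses.not_pos_iff {a b c d : ℝ × ℝ} (h : Crosses a b c d) (hc : orient a b c ≠ 0)
    (hd : orient a b d ≠ 0) : ¬(0 < orient a b c ↔ 0 < orient a b d) := by
  obtain ⟨s, t, hs, ht, h⟩ := h.exists_orient_add_eq_zero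
  rcases lt_or_gt_of_ne hc with hc | hc <;> rcases lt_or_gt_of_ne hd with hd | hd
  · nlinarith [mul_pos hs (neg_pos.2 hc), mul_pos ht (neg_pos.2 hd)]
  · simp [hc.not_gt, hd]
  · simp [hc, hd.not_gt]
  · nlinarith [mul_pos hs hc, mul_pos ht hd]

theorem Crosses.pos_iff {a b c d : ℝ × ℝ} (h : Crosses a b c d) :
    0 < orient a c b ↔ 0 < orient a c d := by
  obtain ⟨s, t, hs, ht, h⟩ := h.exists_orient_eq
  rw [← mul_pos_iff_of_pos_left hs, h, mul_pos_iff_of_pos_left ht]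

theorem Crosses.ne_of_orient_ne_zero {a b d : ℝ × ℝ} (hab : a ≠ b)
    (habd : b ≠ d → orient a b d ≠ 0) : ¬Crosses a b a d := by
  intro h
  by_cases hbd : b = d
  · subst hbd
    obtain ⟨x, -, -, hx⟩ := h
    rw [Set.inter_self] at hx
    have h1 : a ∈ ({x} : Set (ℝ × ℝ)) := hx ▸ left_mem_segment ℝ a b
    have h2 : b ∈ ({x} : Set (ℝ × ℝ)) := hx ▸ right_mem_segment ℝ a b
    exact hab (h1.trans h2.symm)
  · have haa : orient a b a = 0 := by simp only [orient]; ring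
    obtain ⟨s, t, -, ht, h⟩ := h.exists_orient_add_eq_zero
    rw [haa, mul_zero, zero_add] at h
    exact habd hbd ((mul_eq_zero.1 h).resolve_left ht.ne')

/-! ### A set of 25 points without six pairwise crossing segments -/

/-- The abscissas of the 25 base points. -/
def baseXs : List ℕ :=
  [720, 742, 771, 838, 861, 1014, 1009, 885, 1103, 1261, 821, 1148, 826, 826, 1782, 2410, 2497,
    977, 1806, 2248, 324, 294, 208, 57, 41]

/-- The ordinates of the 25 base points, in increasing order. -/
def baseYs : List ℕ :=
  [46, 83, 147, 242, 391, 618, 739, 793, 955, 973, 1008, 1064, 1088, 1093, 1131, 1139, 1151,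
    1152, 1154, 1182, 1731, 1743, 1947, 2199, 2223]

/-- The abscissa of the `i`-th base point. -/
def baseX (i : ℕ) : ℕ := baseXs.getD i 0

/-- The ordinate of the `i`-th base point. -/
def baseY (i : ℕ) : ℕ := baseYs.getD i 0

/-- Whether the base points `i`, `j`, `k` form a left turn. -/
def isLeft (i j k : ℕ) : Bool :=
  Nat.blt (baseX i * baseY k + baseX j * baseY i + baseX k * baseY j)
    (baseX i * baseY j + baseX j * baseY k + baseX k * baseY i)

theorem baseY_strictMono : ∀ j < 25, ∀ i < j, baseY i < baseY j := by
  decide +kernel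

theorem baseX_le : ∀ i < 25, baseX i ≤ 2500 := by
  decide +kernel

theorem baseY_le : ∀ i < 25, baseY i ≤ 2500 := by
  decide +kernel

theorem base_not_collinear : ∀ i < 25, ∀ j < 25, ∀ k < 25, i = j ∨ i = k ∨ j = k ∨
    baseX i * baseY k + baseX j * baseY i + baseX k * baseY j ≠
      baseX i * baseY j + baseX j * baseY k + baseX k * baseY i := by
  decide +kernel

/-- A segment of base points, encoded by two bit masks: the points on its left (to which the upper
endpoint is added, so that segments sharing an endpoint are not reported as crossing), and its two
endpoints. -/
abbrev SegCode := ℕ × ℕ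

/-- The code of the segment joining the base points `i` and `j`. -/
def segCode (i j : ℕ) : SegCode :=
  (Nat.ofBits fun k : Fin 25 => Nat.beq k j || isLeft i j k, Nat.lor (2 ^ i) (2 ^ j))

/-- Whether `m` has a bit inside and a bit outside `s`. -/
def splits (s m : ℕ) : Bool :=
  !(Nat.beq (Nat.land s m) 0) && !(Nat.beq (Nat.land s m) m)

/-- Whether the two encoded segments cross. -/
def codeCross (e f : SegCode) : Bool :=
  splits e.1 f.2 && splits f.1 e.2

/-- The codes of all segments of the base points. -/
def segCodes : List SegCode :=
  (List.range 25).flatMap fun j => (List.range j).map fun i => segCode i j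

/-- `List.filter`, defined by the recursor to make kernel reduction fast. -/
noncomputable def recFilter {α : Type} (p : α → Bool) (l : List α) : List α :=
  List.rec [] (fun a _ ih => Bool.rec ih (a :: ih) (p a)) l

/-- Whether `P` holds, for each suffix `v :: vs` of the list, for the neighbours of `v` in `vs`. -/
noncomputable def allSuffixes {α : Type} (adj : α → α → Bool) (P : List α → Bool)
    (l : List α) : Bool :=
  List.rec true (fun v vs ih => Bool.rec false ih (P (recFilter (adj v) vs))) l

/-- Exhaustive search checking that the list has no `k` pairwise adjacent members. -/
noncomputable def noClique {α : Type} (adj : α → α → Bool) (k : ℕ) : List α → Bool :=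
  Nat.rec (fun _ => false) (fun _ P => allSuffixes adj P) k

theorem mem_recFilter {α : Type} {p : α → Bool} {l : List α} {a : α} (ha : a ∈ l)
    (hp : p a = true) : a ∈ recFilter p l := by
  induction l with
  | nil => simp at ha
  | cons b l ih =>
    change a ∈ (Bool.rec (recFilter p l) (b :: recFilter p l) (p b) : List α)
    rcases List.mem_cons.1 ha with rfl | ha
    · simp [hp]
    · cases p b
      · exact ih ha
      · exact List.mem_cons_of_mem _ (ih ha)

theorem not_clique_of_noClique {α : Type} {adj : α → α → Bool} {k : ℕ} {l : List α}
    (h : noClique adj k l = true) {T : Finset α} (hT : T.card = k) (hl : ∀ a ∈ T, a ∈ l) :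
    ¬∀ a ∈ T, ∀ b ∈ T, a ≠ b → adj a b = true := by
  classical
  intro hadj
  induction k generalizing l T with
  | zero => simp [noClique] at h
  | succ k ihk =>
    induction l with
    | nil =>
      obtain ⟨a, ha⟩ := card_pos.1 (k.succ_pos.trans_eq hT.symm)
      simpa using hl a ha
    | cons v vs ihl =>
      change (Bool.rec false (noClique adj (k + 1) vs)
        (noClique adj k (recFilter (adj v) vs)) : Bool) = true at h
      cases h' : noClique adj k (recFilter (adj v) vs)
      · rw [h'] at h; simp at h
      · rw [h'] at h
        by_cases hv : v ∈ T
        · refine ihk (T := T.erase v) h' (by rw [card_erase_of_mem hv, hT]; rfl) ?_ ?_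
          · intro a ha
            obtain ⟨hav, haT⟩ := mem_erase.1 ha
            exact mem_recFilter ((List.mem_cons.1 (hl a haT)).resolve_left hav)
              (hadj v hv a haT (Ne.symm hav))
          · exact fun a ha b hb => hadj a (mem_of_mem_erase ha) b (mem_of_mem_erase hb)
        · refine ihl h fun a ha => (List.mem_cons.1 (hl a ha)).resolve_left ?_
          rintro rfl
          exact hv ha

theorem noClique_segCodes : noClique codeCross 6 segCodes = true := by
  decide +kernel

theorem mem_segCodes {i j : ℕ} (hij : i < j) (hj : j < 25) : segCode i j ∈ segCodes :=
  List.mem_flatMap.2 ⟨j, List.mem_range.2 hj, List.mem_map.2 ⟨i, List.mem_range.2 hij, rfl⟩⟩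

theorem eq_or_eq_of_segCode_eq {i j k l : ℕ} (h : segCode i j = segCode k l) :
    i = k ∨ i = l := by
  have h' : 2 ^ i ||| 2 ^ j = 2 ^ k ||| 2 ^ l := congrArg Prod.snd h
  have hi : (2 ^ k ||| 2 ^ l).testBit i = true := by rw [← h']; simp
  rw [Nat.testBit_or, Nat.testBit_two_pow, Nat.testBit_two_pow, Bool.or_eq_true,
    decide_eq_true_iff, decide_eq_true_iff] at hi
  exact hi.imp Eq.symm Eq.symm

theorem splits_of_testBit_ne {s i j : ℕ} (h : s.testBit i ≠ s.testBit j) :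
    splits s (Nat.lor (2 ^ i) (2 ^ j)) = true := by
  change splits s (2 ^ i ||| 2 ^ j) = true
  have hi : (s &&& (2 ^ i ||| 2 ^ j)).testBit i = s.testBit i := by simp
  have hj : (s &&& (2 ^ i ||| 2 ^ j)).testBit j = s.testBit j := by simp
  have h0 : s &&& (2 ^ i ||| 2 ^ j) ≠ 0 := by
    intro h0
    rw [h0, Nat.zero_testBit] at hi hj
    exact h (hi.symm.trans hj)
  have h1 : s &&& (2 ^ i ||| 2 ^ j) ≠ 2 ^ i ||| 2 ^ j := by
    intro h1
    rw [h1] at hi hj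
    exact h (hi.symm.trans (Eq.trans (by simp) hj))
  have h0' : Nat.beq (Nat.land s (2 ^ i ||| 2 ^ j)) 0 = false :=
    Bool.eq_false_iff.2 fun h => h0 (Nat.eq_of_beq_eq_true h)
  have h1' : Nat.beq (Nat.land s (2 ^ i ||| 2 ^ j)) (2 ^ i ||| 2 ^ j) = false :=
    Bool.eq_false_iff.2 fun h => h1 (Nat.eq_of_beq_eq_true h)
  rw [splits, h0', h1']
  rfl

theorem testBit_segCode {i j k : ℕ} (hk : k < 25) (hkj : k ≠ j) :
    (segCode i j).1.testBit k = isLeft i j k := by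
  have : Nat.beq k j = false :=
    Bool.eq_false_iff.2 fun h => hkj (Nat.eq_of_beq_eq_true h)
  simp [segCode, Nat.testBit_ofBits_lt _ _ hk, this]

theorem codeCross_segCode {i j k l : ℕ} (hi : i < 25) (hj : j < 25) (hk : k < 25) (hl : l < 25)
    (hil : i ≠ l) (hjk : j ≠ k) (hjl : j ≠ l) (h : isLeft i j k ≠ isLeft i j l)
    (h' : isLeft k l i ≠ isLeft k l j) : codeCross (segCode i j) (segCode k l) = true := by
  rw [codeCross, Bool.and_eq_true]
  constructor <;> apply splits_of_testBit_ne
  · rwa [testBit_segCode hk hjk.symm, testBit_segCode hl hjl.symm]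
  · rwa [testBit_segCode hi hil, testBit_segCode hj hjl]

/-! ### The blown-up point set -/

/-- The point with parameter `u` of the flat cluster, on a parabola, at the `i`-th base point. -/
def clusterPoint (i : ℕ) (u : ℝ) : ℝ × ℝ :=
  (baseX i + u, baseY i + u ^ 2)

theorem orient_clusterPoint_self (i : ℕ) (u v w : ℝ) :
    orient (clusterPoint i u) (clusterPoint i v) (clusterPoint i w) =
      (v - u) * (w - u) * (w - v) := by
  simp only [orient, clusterPoint]; ring

theorem abs_baseX_sub_le {i j : ℕ} (hi : i < 25) (hj : j < 25) :
    |(baseX i : ℝ) - baseX j| ≤ 2500 := by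
  have h1 : (baseX i : ℝ) ≤ 2500 := by exact_mod_cast baseX_le i hi
  have h2 : (baseX j : ℝ) ≤ 2500 := by exact_mod_cast baseX_le j hj
  have h3 : (0 : ℝ) ≤ baseX i := by positivity
  have h4 : (0 : ℝ) ≤ baseX j := by positivity
  rw [abs_le]; constructor <;> linarith

theorem abs_baseY_sub_le {i j : ℕ} (hi : i < 25) (hj : j < 25) :
    |(baseY i : ℝ) - baseY j| ≤ 2500 := by
  have h1 : (baseY i : ℝ) ≤ 2500 := by exact_mod_cast baseY_le i hi
  have h2 : (baseY j : ℝ) ≤ 2500 := by exact_mod_cast baseY_le j hj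
  have h3 : (0 : ℝ) ≤ baseY i := by positivity
  have h4 : (0 : ℝ) ≤ baseY j := by positivity
  rw [abs_le]; constructor <;> linarith

/-- The admissible range of cluster parameters. -/
abbrev clusterRange : Set ℝ := Set.Icc 0 (1 / 20000)

theorem sq_mem_clusterRange {u : ℝ} (hu : u ∈ clusterRange) : u ^ 2 ∈ clusterRange := by
  obtain ⟨h0, h1⟩ := hu
  exact ⟨by positivity, by nlinarith⟩

theorem abs_sub_le_of_mem_clusterRange {u v : ℝ} (hu : u ∈ clusterRange)
    (hv : v ∈ clusterRange) : |u - v| ≤ 1 / 20000 := by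
  rw [abs_le]; constructor <;> linarith [hu.1, hu.2, hv.1, hv.2]

theorem orient_clusterPoint_same {i k : ℕ} (hi : i < 25) (hk : k < 25) (hik : i ≠ k)
    {u v w : ℝ} (hu : u ∈ clusterRange) (hv : v ∈ clusterRange) (hw : w ∈ clusterRange)
    (huv : u < v) :
    orient (clusterPoint i u) (clusterPoint i v) (clusterPoint k w) ≠ 0 ∧
      (0 < orient (clusterPoint i u) (clusterPoint i v) (clusterPoint k w) ↔ i < k) := by
  have hfac : orient (clusterPoint i u) (clusterPoint i v) (clusterPoint k w) = (v - u) *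
      ((baseY k - baseY i + (w ^ 2 - u ^ 2)) - (u + v) * (baseX k - baseX i + (w - u))) := by
    simp only [orient, clusterPoint]; ring
  have hsq := abs_le.1 (abs_sub_le_of_mem_clusterRange (sq_mem_clusterRange hw)
    (sq_mem_clusterRange hu))
  have hslope : |(u + v) * ((baseX k : ℝ) - baseX i + (w - u))| ≤ 1 / 10000 * 2501 := by
    rw [abs_mul]
    refine mul_le_mul ?_ ?_ (abs_nonneg _) (by norm_num)
    · rw [abs_le]; constructor <;> linarith [hu.1, hu.2, hv.1, hv.2]
    · refine (abs_add_le _ _).trans ?_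
      linarith [abs_baseX_sub_le hk hi, abs_sub_le_of_mem_clusterRange hw hu]
  have hslope' := abs_le.1 hslope
  rw [hfac, mul_pos_iff_of_pos_left (sub_pos.2 huv)]
  rcases lt_or_gt_of_ne hik with h | h
  · have hy : (baseY i : ℝ) + 1 ≤ baseY k := by exact_mod_cast baseY_strictMono k hk i h
    have : 0 < (baseY k - baseY i + (w ^ 2 - u ^ 2)) -
        (u + v) * ((baseX k : ℝ) - baseX i + (w - u)) := by linarith [hsq.1, hslope'.2]
    exact ⟨(mul_pos (sub_pos.2 huv) this).ne', by simp [this, h]⟩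
  · have hy : (baseY k : ℝ) + 1 ≤ baseY i := by exact_mod_cast baseY_strictMono i hi k h
    have : (baseY k - baseY i + (w ^ 2 - u ^ 2)) -
        (u + v) * ((baseX k : ℝ) - baseX i + (w - u)) < 0 := by linarith [hsq.2, hslope'.1]
    exact ⟨(mul_neg_of_pos_of_neg (sub_pos.2 huv) this).ne, by simp [this.not_gt, h.not_gt]⟩

theorem orient_clusterPoint_of_ne {i j k : ℕ} (hi : i < 25) (hj : j < 25) (hk : k < 25)
    (hij : i ≠ j) (hik : i ≠ k) (hjk : j ≠ k) {u v w : ℝ} (hu : u ∈ clusterRange)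
    (hv : v ∈ clusterRange) (hw : w ∈ clusterRange) :
    orient (clusterPoint i u) (clusterPoint j v) (clusterPoint k w) ≠ 0 ∧
      (0 < orient (clusterPoint i u) (clusterPoint j v) (clusterPoint k w) ↔
        isLeft i j k = true) := by
  have hprod : ∀ a b A B : ℝ, |a| ≤ A → |b| ≤ B → |a * b| ≤ A * B := fun a b A B ha hb => by
    rw [abs_mul]; exact mul_le_mul ha hb (abs_nonneg _) ((abs_nonneg _).trans ha)
  have e1 := abs_le.1 <| hprod _ _ _ _ (abs_baseX_sub_le hj hi)
    (abs_sub_le_of_mem_clusterRange (sq_mem_clusterRange hw) (sq_mem_clusterRange hu))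
  have e2 := abs_le.1 <| hprod _ _ _ _ (abs_sub_le_of_mem_clusterRange hv hu)
    (abs_baseY_sub_le hk hi)
  have e3 := abs_le.1 <| hprod _ _ _ _ (abs_sub_le_of_mem_clusterRange hv hu)
    (abs_sub_le_of_mem_clusterRange (sq_mem_clusterRange hw) (sq_mem_clusterRange hu))
  have e4 := abs_le.1 <| hprod _ _ _ _ (abs_sub_le_of_mem_clusterRange (sq_mem_clusterRange hv)
    (sq_mem_clusterRange hu)) (abs_baseX_sub_le hk hi)
  have e5 := abs_le.1 <| hprod _ _ _ _ (abs_baseY_sub_le hj hi)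
    (abs_sub_le_of_mem_clusterRange hw hu)
  have e6 := abs_le.1 <| hprod _ _ _ _ (abs_sub_le_of_mem_clusterRange (sq_mem_clusterRange hv)
    (sq_mem_clusterRange hu)) (abs_sub_le_of_mem_clusterRange hw hu)
  have hexp : orient (clusterPoint i u) (clusterPoint j v) (clusterPoint k w) =
      ((baseX i * baseY j + baseX j * baseY k + baseX k * baseY i : ℕ) : ℝ) -
        ((baseX i * baseY k + baseX j * baseY i + baseX k * baseY j : ℕ) : ℝ) +
      ((baseX j - baseX i) * (w ^ 2 - u ^ 2) + (v - u) * (baseY k - baseY i) +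
        (v - u) * (w ^ 2 - u ^ 2) - (v ^ 2 - u ^ 2) * (baseX k - baseX i) -
        (baseY j - baseY i) * (w - u) - (v ^ 2 - u ^ 2) * (w - u)) := by
    simp only [orient, clusterPoint]; push_cast; ring
  rw [isLeft, Nat.blt_eq]
  have hne := base_not_collinear i hi j hj k hk
  simp only [hij, hik, hjk, false_or] at hne
  rcases lt_or_gt_of_ne hne with h | h
  · have h' := Nat.succ_le_of_lt h
    rw [← @Nat.cast_le ℝ, Nat.cast_succ] at h'
    have hpos : 0 < orient (clusterPoint i u) (clusterPoint j v) (clusterPoint k w) := by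
      linarith [hexp, e1.1, e2.1, e3.1, e4.2, e5.2, e6.2]
    exact ⟨hpos.ne', by simp only [hpos, h]⟩
  · have h' := Nat.succ_le_of_lt h
    rw [← @Nat.cast_le ℝ, Nat.cast_succ] at h'
    have hneg : orient (clusterPoint i u) (clusterPoint j v) (clusterPoint k w) < 0 := by
      linarith [hexp, e1.2, e2.2, e3.2, e4.1, e5.1, e6.1]
    exact ⟨hneg.ne, by simp only [hneg.not_gt, h.not_gt]⟩

/-- The `j`-th of the `t` parameters used in each cluster. -/
noncomputable def clusterParam (t : ℕ) (j : Fin t) : ℝ :=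
  1 / 20000 * (j / t)

theorem clusterParam_mem {t : ℕ} (j : Fin t) : clusterParam t j ∈ clusterRange := by
  have ht : (0 : ℝ) < t := by exact_mod_cast j.pos
  have hj : (j : ℝ) / t ≤ 1 := by
    rw [div_le_one ht]; exact_mod_cast j.2.le
  exact ⟨by unfold clusterParam; positivity, by unfold clusterParam; linarith⟩

theorem clusterParam_strictMono (t : ℕ) : StrictMono (clusterParam t) := by
  intro j k hjk
  have ht : (0 : ℝ) < t := by exact_mod_cast j.pos
  have hjk' : (j : ℝ) < k := by exact_mod_cast hjk
  unfold clusterParam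
  gcongr

/-- The blow-up of the 25 base points, each replaced by a cluster of `t` points. -/
noncomputable def blowUp (t : ℕ) (a : Fin 25 × Fin t) : ℝ × ℝ :=
  clusterPoint a.1 (clusterParam t a.2)

section BlowUp

variable {t : ℕ} {a b c d : Fin 25 × Fin t}

theorem orient_blowUp_of_ne (hab : a.1 ≠ b.1) (hac : a.1 ≠ c.1) (hbc : b.1 ≠ c.1) :
    orient (blowUp t a) (blowUp t b) (blowUp t c) ≠ 0 ∧
      (0 < orient (blowUp t a) (blowUp t b) (blowUp t c) ↔ isLeft a.1 b.1 c.1 = true) :=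
  orient_clusterPoint_of_ne a.1.2 b.1.2 c.1.2 (Fin.val_ne_of_ne hab) (Fin.val_ne_of_ne hac)
    (Fin.val_ne_of_ne hbc) (clusterParam_mem _) (clusterParam_mem _) (clusterParam_mem _)

theorem orient_blowUp_of_lt (hab : a.1 = b.1) (hac : a.1 ≠ c.1) (hlt : a.2 < b.2) :
    orient (blowUp t a) (blowUp t b) (blowUp t c) ≠ 0 ∧
      (0 < orient (blowUp t a) (blowUp t b) (blowUp t c) ↔ a.1 < c.1) := by
  have h := orient_clusterPoint_same a.1.2 c.1.2 (Fin.val_ne_of_ne hac) (clusterParam_mem a.2)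
    (clusterParam_mem b.2) (clusterParam_mem c.2) (clusterParam_strictMono t hlt)
  simpa only [blowUp, ← hab, Fin.lt_def] using h

theorem orient_blowUp_of_eq_ne (hne : a ≠ b) (hab : a.1 = b.1) (hac : a.1 ≠ c.1) :
    orient (blowUp t a) (blowUp t b) (blowUp t c) ≠ 0 := by
  rcases lt_or_gt_of_ne (fun h => hne (Prod.ext hab h) : a.2 ≠ b.2) with h | h
  · exact (orient_blowUp_of_lt hab hac h).1
  · rw [orient_swap]
    exact neg_ne_zero.2 (orient_blowUp_of_lt hab.symm (hab ▸ hac) h).1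

theorem orient_blowUp_ne_zero (hab : a ≠ b) (hac : a ≠ c) (hbc : b ≠ c) :
    orient (blowUp t a) (blowUp t b) (blowUp t c) ≠ 0 := by
  by_cases h1 : a.1 = b.1
  · by_cases h2 : a.1 = c.1
    · have hparam : ∀ {x y : Fin 25 × Fin t}, x ≠ y → x.1 = y.1 →
          clusterParam t y.2 - clusterParam t x.2 ≠ 0 := fun hxy h =>
        sub_ne_zero.2 fun h' =>
          hxy (Prod.ext h ((clusterParam_strictMono t).injective h').symm)
      have h := orient_clusterPoint_self a.1 (clusterParam t a.2) (clusterParam t b.2)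
        (clusterParam t c.2)
      rw [blowUp, blowUp, blowUp, ← h1, ← h2, h]
      exact mul_ne_zero (mul_ne_zero (hparam hab h1) (hparam hac h2))
        (hparam hbc (h1.symm.trans h2))
    · exact orient_blowUp_of_eq_ne hab h1 h2
  · by_cases h2 : a.1 = c.1
    · rw [← orient_rotate, ← orient_rotate]
      exact orient_blowUp_of_eq_ne hac.symm h2.symm (h2 ▸ h1)
    · by_cases h3 : b.1 = c.1
      · rw [← orient_rotate]
        exact orient_blowUp_of_eq_ne hbc h3 (Ne.symm h1)
      · exact (orient_blowUp_of_ne h1 h2 h3).1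

theorem blowUp_injective (t : ℕ) : Function.Injective (blowUp t) := by
  intro a b hab
  by_contra hne
  obtain ⟨i, hi⟩ : ∃ i : Fin 25, i ≠ a.1 ∧ i ≠ b.1 := by
    have : ∀ x y : Fin 25, ∃ i : Fin 25, i ≠ x ∧ i ≠ y := by decide
    exact this _ _
  have h := orient_blowUp_ne_zero (c := (i, a.2)) hne (fun h => hi.1 (congrArg Prod.fst h).symm)
    (fun h => hi.2 (congrArg Prod.fst h).symm)
  rw [hab] at h
  exact h (by simp only [orient]; ring)

theorem ne_of_crosses_blowUp (hab : a ≠ b)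
    (h : Crosses (blowUp t a) (blowUp t b) (blowUp t c) (blowUp t d)) (hcd : c ≠ d) : a ≠ c := by
  rintro rfl
  exact Crosses.ne_of_orient_ne_zero ((blowUp_injective t).ne hab)
    (fun hbd => orient_blowUp_ne_zero hab hcd fun h => hbd (congrArg _ h)) h

/-- Segments leaving a cluster upwards do not cross segments leaving it downwards. -/
theorem not_crosses_blowUp_of_up_down (hab : a ≠ b) (h : a.1 = b.1) (hc : a.1 < c.1)
    (hd : d.1 < b.1) : ¬Crosses (blowUp t a) (blowUp t c) (blowUp t b) (blowUp t d) := by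
  intro hcr
  have hda : d.1 < a.1 := h ▸ hd
  rcases lt_or_gt_of_ne (fun h' => hab (Prod.ext h h') : a.2 ≠ b.2) with hlt | hlt
  · have := hcr.pos_iff
    rw [(orient_blowUp_of_lt h hc.ne hlt).2, (orient_blowUp_of_lt h hda.ne' hlt).2] at this
    exact hda.not_gt (this.1 hc)
  · have := hcr.symm.pos_iff
    rw [(orient_blowUp_of_lt h.symm hd.ne' hlt).2,
      (orient_blowUp_of_lt h.symm (h ▸ hc.ne) hlt).2] at this
    exact hd.not_gt (this.2 (h ▸ hc))

/-- A segment crossing a segment inside a cluster has an endpoint in that cluster. -/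
theorem mem_cluster_of_crosses (hab : a ≠ b) (h : a.1 = b.1)
    (hcr : Crosses (blowUp t a) (blowUp t b) (blowUp t c) (blowUp t d)) :
    c.1 = a.1 ∨ d.1 = a.1 := by
  wlog hlt : a.2 < b.2 generalizing a b
  · rw [h]
    exact this hab.symm h.symm hcr.swap_left
      (lt_of_le_of_ne (not_lt.1 hlt) fun h' => hab (Prod.ext h h'.symm))
  by_contra! hne
  have hc := orient_blowUp_of_lt h hne.1.symm hlt
  have hd := orient_blowUp_of_lt h hne.2.symm hlt
  have hside := hcr.not_pos_iff hc.1 hd.1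
  rw [hc.2, hd.2] at hside
  by_cases hcd' : c.1 = d.1
  · exact hside (by rw [hcd'])
  · have ha := orient_blowUp_of_ne (c := a) hcd' hne.1 hne.2
    have hb := orient_blowUp_of_ne (c := b) hcd' (h ▸ hne.1) (h ▸ hne.2)
    refine hcr.symm.not_pos_iff ha.1 hb.1 ?_
    rw [ha.2, hb.2, h]

theorem codeCross_of_crosses (hab : a.1 ≠ b.1) (hac : a.1 ≠ c.1) (had : a.1 ≠ d.1)
    (hbc : b.1 ≠ c.1) (hbd : b.1 ≠ d.1) (hcd : c.1 ≠ d.1)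
    (hcr : Crosses (blowUp t a) (blowUp t b) (blowUp t c) (blowUp t d)) :
    codeCross (segCode a.1 b.1) (segCode c.1 d.1) = true := by
  have h1 := orient_blowUp_of_ne hab hac hbc
  have h2 := orient_blowUp_of_ne hab had hbd
  have h3 := orient_blowUp_of_ne hcd hac.symm had.symm
  have h4 := orient_blowUp_of_ne hcd hbc.symm hbd.symm
  refine codeCross_segCode a.1.2 b.1.2 c.1.2 d.1.2 (Fin.val_ne_of_ne had)
    (Fin.val_ne_of_ne hbc) (Fin.val_ne_of_ne hbd) (fun h => ?_) (fun h => ?_)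
  · exact hcr.not_pos_iff h1.1 h2.1 (by rw [h1.2, h2.2, h])
  · exact hcr.symm.not_pos_iff h3.1 h4.1 (by rw [h3.2, h4.2, h])

end BlowUp

/-- A finite family of pairwise crossing segments `u e`, `v e` of the blow-up, oriented upwards. -/
structure UpwardCrossingFamily (t : ℕ) {E : Type*} (u v : E → Fin 25 × Fin t) : Prop where
  ne : ∀ e, u e ≠ v e
  le : ∀ e, (u e).1 ≤ (v e).1
  crosses : ∀ e f, e ≠ f →
    Crosses (blowUp t (u e)) (blowUp t (v e)) (blowUp t (u f)) (blowUp t (v f))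

namespace UpwardCrossingFamily

variable {t : ℕ} {E : Type*} {u v : E → Fin 25 × Fin t}

theorem left_injective (h : UpwardCrossingFamily t u v) : Function.Injective u := by
  intro e f hef
  by_contra hne
  exact ne_of_crosses_blowUp (h.ne e) (h.crosses e f hne) (h.ne f) hef

theorem right_injective (h : UpwardCrossingFamily t u v) : Function.Injective v := by
  intro e f hef
  by_contra hne
  exact ne_of_crosses_blowUp (h.ne e).symm (h.crosses e f hne).swap_left.swap_right
    (h.ne f).symm hef

theorem left_ne_right (h : UpwardCrossingFamily t u v) (e f : E) : u e ≠ v f := by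
  rcases eq_or_ne e f with rfl | hne
  · exact h.ne e
  · exact ne_of_crosses_blowUp (h.ne e) (h.crosses e f hne).swap_right (h.ne f).symm

theorem card_le_of_fst_eq [Fintype E] (h : UpwardCrossingFamily t u v) {e : E}
    (he : (u e).1 = (v e).1) : Fintype.card E ≤ t := by
  classical
  have hmem : ∀ f, (u f).1 = (u e).1 ∨ (v f).1 = (u e).1 := by
    intro f
    rcases eq_or_ne e f with rfl | hne
    · exact Or.inl rfl
    · exact mem_cluster_of_crosses (h.ne e) he (h.crosses e f hne)
  let w : E → Fin 25 × Fin t := fun f => if (u f).1 = (u e).1 then u f else v f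
  have hw : ∀ f, (w f).1 = (u e).1 := by
    intro f
    by_cases hf : (u f).1 = (u e).1
    · simp [w, hf]
    · simpa [w, hf] using (hmem f).resolve_left hf
  have hwinj : Function.Injective fun f => (w f).2 := by
    intro f g hfg
    have hfg' : w f = w g := Prod.ext ((hw f).trans (hw g).symm) hfg
    simp only [w] at hfg'
    split_ifs at hfg'
    · exact h.left_injective hfg'
    · exact absurd hfg' (h.left_ne_right f g)
    · exact absurd hfg'.symm (h.left_ne_right g f)
    · exact h.right_injective hfg'
  simpa using Fintype.card_le_of_injective _ hwinj

theorem card_ne_six_of_injOn (h : UpwardCrossingFamily t u v) (hlt : ∀ e, (u e).1 < (v e).1)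
    {M : Finset E} (hl : Set.InjOn (fun e => (u e).1) M) (hr : Set.InjOn (fun e => (v e).1) M) :
    M.card ≠ 6 := by
  classical
  intro hM
  have hlr : ∀ e f, (u e).1 ≠ (v f).1 := by
    intro e f hef
    rcases eq_or_ne e f with rfl | hne
    · exact (hlt e).ne hef
    · exact not_crosses_blowUp_of_up_down (h.left_ne_right e f) hef (hlt e) (hlt f)
        (h.crosses e f hne).swap_right
  have hadj : ∀ e ∈ M, ∀ f ∈ M, e ≠ f →
      codeCross (segCode (u e).1 (v e).1) (segCode (u f).1 (v f).1) = true :=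
    fun e he f hf hef => codeCross_of_crosses (hlt e).ne (hl.ne he hf hef) (hlr e f)
      (hlr f e).symm (hr.ne he hf hef) (hlt f).ne (h.crosses e f hef)
  have hinj : Set.InjOn (fun e => segCode (u e).1 (v e).1) M := fun e he f hf hef =>
    hl he hf (Fin.ext ((eq_or_eq_of_segCode_eq hef).resolve_right (Fin.val_ne_of_ne (hlr e f))))
  refine not_clique_of_noClique noClique_segCodes
    (T := M.image fun e => segCode (u e).1 (v e).1) (by rw [card_image_of_injOn hinj, hM]) ?_ ?_
  · intro c hc
    obtain ⟨e, -, rfl⟩ := mem_image.1 hc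
    exact mem_segCodes (hlt e) (v e).1.2
  · intro c hc d hd hcd
    obtain ⟨e, he, rfl⟩ := mem_image.1 hc
    obtain ⟨f, hf, rfl⟩ := mem_image.1 hd
    exact hadj e he f hf fun hef => hcd (by rw [hef])

theorem card_le [Fintype E] (h : UpwardCrossingFamily t u v) : Fintype.card E ≤ 5 * t := by
  classical
  by_cases hloop : ∃ e, (u e).1 = (v e).1
  · obtain ⟨e, he⟩ := hloop
    have := h.card_le_of_fst_eq he
    omega
  · push Not at hloop
    rcases exists_matching_or_cover (fun e => (u e).1) (fun e => (v e).1) 5 with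
      ⟨M, hM, hl, hr⟩ | ⟨A, B, hAB, hcov⟩
    · exact absurd hM
        (h.card_ne_six_of_injOn (fun e => lt_of_le_of_ne (h.le e) (hloop e)) hl hr)
    · have hsub : (univ : Finset E) ⊆
          (univ.filter fun e => (u e).1 ∈ A) ∪ univ.filter fun e => (v e).1 ∈ B := by
        intro e _
        simpa using hcov e
      have hA : (univ.filter fun e => (u e).1 ∈ A).card ≤ A.card * t := by
        have := card_le_card_of_injOn (s := univ.filter fun e => (u e).1 ∈ A)
          (t := A ×ˢ (univ : Finset (Fin t))) u (by intro e; simp) h.left_injective.injOn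
        simpa using this
      have hB : (univ.filter fun e => (v e).1 ∈ B).card ≤ B.card * t := by
        have := card_le_card_of_injOn (s := univ.filter fun e => (v e).1 ∈ B)
          (t := B ×ˢ (univ : Finset (Fin t))) v (by intro e; simp) h.right_injective.injOn
        simpa using this
      calc Fintype.card E = (univ : Finset E).card := card_univ.symm
        _ ≤ _ := card_le_card hsub
        _ ≤ _ := card_union_le _ _
        _ ≤ A.card * t + B.card * t := add_le_add hA hB
        _ = (A.card + B.card) * t := (add_mul _ _ _).symm
        _ ≤ 5 * t := Nat.mul_le_mul_right t hAB

end UpwardCrossingFamily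

theorem genPos_of_subset_range_blowUp {t : ℕ} {S : Finset (ℝ × ℝ)}
    (hS : ∀ p ∈ S, ∃ a, blowUp t a = p) : GenPos S := by
  intro p hp q hq r hr hpq hpr hqr hcol
  obtain ⟨a, rfl⟩ := hS p hp
  obtain ⟨b, rfl⟩ := hS q hq
  obtain ⟨c, rfl⟩ := hS r hr
  exact orient_blowUp_ne_zero (ne_of_apply_ne _ hpq) (ne_of_apply_ne _ hpr)
    (ne_of_apply_ne _ hqr) (orient_eq_zero_of_collinear hcol)

theorem IsCrossingFamily.card_le_of_subset_range_blowUp {t : ℕ} {S : Finset (ℝ × ℝ)}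
    (hS : ∀ p ∈ S, ∃ a, blowUp t a = p) {F : Finset ((ℝ × ℝ) × (ℝ × ℝ))}
    (hF : IsCrossingFamily S F) : F.card ≤ 5 * t := by
  have hlabel : ∀ e : F, ∃ a b, a ≠ b ∧ a.1 ≤ b.1 ∧
      ((blowUp t a = e.1.1 ∧ blowUp t b = e.1.2) ∨
        (blowUp t a = e.1.2 ∧ blowUp t b = e.1.1)) := by
    rintro ⟨⟨p, q⟩, he⟩
    obtain ⟨hp, hq, hpq⟩ := hF.1 _ he
    obtain ⟨a, rfl⟩ := hS p hp
    obtain ⟨b, rfl⟩ := hS q hq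
    rcases le_total a.1 b.1 with hab | hab
    · exact ⟨a, b, ne_of_apply_ne (blowUp t) hpq, hab, Or.inl ⟨rfl, rfl⟩⟩
    · exact ⟨b, a, (ne_of_apply_ne (blowUp t) hpq).symm, hab, Or.inr ⟨rfl, rfl⟩⟩
  choose u v hne hle hends using hlabel
  have hfam : UpwardCrossingFamily t u v := by
    refine ⟨hne, hle, fun e f hef => ?_⟩
    have hcr := hF.2 e e.2 f f.2 (fun h => hef (Subtype.ext h))
    rcases hends e with ⟨h1, h2⟩ | ⟨h1, h2⟩ <;> rcases hends f with ⟨h3, h4⟩ | ⟨h3, h4⟩ <;>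
      rw [h1, h2, h3, h4]
    · exact hcr
    · exact hcr.swap_right
    · exact hcr.swap_left
    · exact hcr.swap_left.swap_right
  simpa using hfam.card_le

theorem cf_le_of_subset_range_blowUp {t : ℕ} {S : Finset (ℝ × ℝ)}
    (hS : ∀ p ∈ S, ∃ a, blowUp t a = p) : cf S ≤ 5 * t := by
  refine csSup_le ⟨0, ∅, ⟨by simp, by simp⟩, rfl⟩ ?_
  rintro k ⟨F, hF, rfl⟩
  exact hF.card_le_of_subset_range_blowUp hS

/-- For every positive integer `n`, `cf(n) ≤ 5 * ⌈n / 25⌉`: there exists a set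
of `n` points in the plane in general position whose largest crossing family
has size at most `5 * ⌈n / 25⌉`. -/
theorem cfNat_le_5_mul_ceilDiv_25 (n : ℕ) (hn : 0 < n) :
    cfNat n ≤ 5 * (n ⌈/⌉ 25) ∧
    ∃ S : Finset (ℝ × ℝ), S.card = n ∧ GenPos S ∧ cf S ≤ 5 * (n ⌈/⌉ 25) := by
  have hex : ∃ S : Finset (ℝ × ℝ), S.card = n ∧ GenPos S ∧ cf S ≤ 5 * (n ⌈/⌉ 25) := by
    have hcard : n ≤ ((univ : Finset (Fin 25 × Fin (n ⌈/⌉ 25))).map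
        ⟨blowUp _, blowUp_injective _⟩).card := by
      simp only [card_map, card_univ, Fintype.card_prod, Fintype.card_fin]
      exact le_smul_ceilDiv (a := 25) (b := n) (by norm_num)
    obtain ⟨S, hS, hSn⟩ := exists_subset_card_eq hcard
    have hS' : ∀ p ∈ S, ∃ a, blowUp (n ⌈/⌉ 25) a = p := fun p hp => by
      obtain ⟨a, -, ha⟩ := mem_map.1 (hS hp)
      exact ⟨a, ha⟩
    exact ⟨S, hSn, genPos_of_subset_range_blowUp hS', cf_le_of_subset_range_blowUp hS'⟩
  obtain ⟨S, hSn, hgp, hcf⟩ := hex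
  have hle : cfNat n ≤ cf S := Nat.sInf_le ⟨S, hSn, hgp, rfl⟩
  exact ⟨hle.trans hcf, S, hSn, hgp, hcf⟩
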